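/- Let M be the 6×6 matrix over ℤ[q] with rows: row 1: (q⁴+q³−q²−q, q³−q, q⁵−2q⁴−q³+2q², q⁵−q³, q⁶−2q⁵−q⁴+2q, −2q⁴−q³+2q²+q); row 2: (q³−q, q⁴+q³−q²−q, q⁵−q³, q⁵−2q⁴−q³+2q², q⁶−2q⁵−q⁴+2q, −2q⁴−q³+2q²+q); row 3: (q³−2q², q³, q⁵+q⁴−3q³+3q², q⁵−3q³, q⁶−2q⁵−3q⁴+4q³, −2q⁴+2q³); row 4: (q³, q³−2q², q⁵−3q³, q⁵+q⁴−3q³+3q², q⁶−2q⁵−3q⁴+4q³, −2q⁴+2q³); row 5: (q³, q³, q⁵−3q³, q⁵−3q³, q⁶−2q⁵−2q⁴+4q³+q², −2q⁴); row 6: (−1, −1, 2q², 2q², −4q²+2, q⁴−2q²+2q+1). For g ≥ 0 set v^g = M^g·(1,0,0,0,0,0)ᵗ and write v^g = (ẽ₀^g, ẽ₁^g, ẽ₂^g, ẽ₃^g, ã^g, b̃^g). Then for every g ≥ 1, the identity 2·b̃^g = 2(q²−1)^{2g−1} − (q²+q)^{2g−1} − (q²−q)^{2g−1} holds in ℤ[q].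 -/

import Mathlib

open Polynomial Matrix

noncomputable section

/-- The indeterminate `q` of `ℤ[q]`. -/
def q : Polynomial ℤ := Polynomial.X

/-- The transition matrix `M` of the genus-adding handle attachment. -/
def M : Matrix (Fin 6) (Fin 6) (Polynomial ℤ) :=
  !![q^4+q^3-q^2-q, q^3-q, q^5-2*q^4-q^3+2*q^2, q^5-q^3, q^6-2*q^5-q^4+2*q, -2*q^4-q^3+2*q^2+q;
     q^3-q, q^4+q^3-q^2-q, q^5-q^3, q^5-2*q^4-q^3+2*q^2, q^6-2*q^5-q^4+2*q, -2*q^4-q^3+2*q^2+q;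
     q^3-2*q^2, q^3, q^5+q^4-3*q^3+3*q^2, q^5-3*q^3, q^6-2*q^5-3*q^4+4*q^3, -2*q^4+2*q^3;
     q^3, q^3-2*q^2, q^5-3*q^3, q^5+q^4-3*q^3+3*q^2, q^6-2*q^5-3*q^4+4*q^3, -2*q^4+2*q^3;
     q^3, q^3, q^5-3*q^3, q^5-3*q^3, q^6-2*q^5-2*q^4+4*q^3+q^2, -2*q^4;
     -1, -1, 2*q^2, 2*q^2, -4*q^2+2, q^4-2*q^2+2*q+1]

/-- `v g = M^g · (1,0,0,0,0,0)ᵗ`, whose components are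
`(ẽ₀^g, ẽ₁^g, ẽ₂^g, ẽ₃^g, ã^g, b̃^g)`. -/
def v (g : ℕ) : Fin 6 → Polynomial ℤ :=
  (M ^ g).mulVec ![1, 0, 0, 0, 0, 0]

theorem v_zero : v 0 = ![1, 0, 0, 0, 0, 0] := by
  simp [v]

theorem v_succ (g : ℕ) : v (g + 1) = M.mulVec (v g) := by
  simp [v, pow_succ', Matrix.mulVec_mulVec]

/-- Pairing `v g` with a left eigenvector of `M` gives a geometric progression. -/
theorem dotProduct_v_of_vecMul_eq {w : Fin 6 → Polynomial ℤ} {μ : Polynomial ℤ}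
    (h : w ᵥ* M = μ • w) (g : ℕ) : w ⬝ᵥ v g = μ ^ g * w 0 := by
  induction g with
  | zero => simp [v_zero, dotProduct, Fin.sum_univ_succ]
  | succ n ih =>
    rw [v_succ, dotProduct_mulVec, h, smul_dotProduct, ih, smul_eq_mul]
    ring

theorem vecMul_M_sq_sub_one :
    ![1, 1, 0, 0, -2, q^2 - 2*q - 1] ᵥ* M =
      (q^2 - 1)^2 • ![1, 1, 0, 0, -2, q^2 - 2*q - 1] := by
  funext j
  fin_cases j <;> simp [M, vecMul, dotProduct, Fin.sum_univ_succ] <;> ring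

theorem vecMul_M_sq_add_self :
    ![1, 1, -(q + 1), -(q + 1), 2*q, -2*q] ᵥ* M =
      (q^2 + q)^2 • ![1, 1, -(q + 1), -(q + 1), 2*q, -2*q] := by
  funext j
  fin_cases j <;> simp [M, vecMul, dotProduct, Fin.sum_univ_succ] <;> ring

theorem vecMul_M_sq_sub_self :
    ![1, 1, q - 1, q - 1, -2*q, -2*q] ᵥ* M =
      (q^2 - q)^2 • ![1, 1, q - 1, q - 1, -2*q, -2*q] := by
  funext j
  fin_cases j <;> simp [M, vecMul, dotProduct, Fin.sum_univ_succ] <;> ring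

theorem stmt_5 (g : ℕ) (hg : 1 ≤ g) :
    2 * v g 5 =
      2*(q^2-1)^(2*g-1) - (q^2+q)^(2*g-1) - (q^2-q)^(2*g-1) := by
  have h₀ := dotProduct_v_of_vecMul_eq vecMul_M_sq_sub_one g
  have h₁ := dotProduct_v_of_vecMul_eq vecMul_M_sq_add_self g
  have h₂ := dotProduct_v_of_vecMul_eq vecMul_M_sq_sub_self g
  have hpow (a : Polynomial ℤ) : (a ^ 2) ^ g = a ^ (2 * g - 1) * a := by
    rw [← pow_mul, ← pow_succ]
    congr 1
    omega
  rw [hpow] at h₀ h₁ h₂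
  simp only [dotProduct, Fin.sum_univ_six, cons_val] at h₀ h₁ h₂
  have hq : q ≠ 0 := X_ne_zero
  have hq' : q ^ 2 - 1 ≠ 0 := X_pow_sub_C_ne_zero (by norm_num) 1
  apply mul_left_cancel₀ (mul_ne_zero hq hq')
  linear_combination (2*q) * h₀ - (q - 1) * h₁ - (q + 1) * h₂
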